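/- Let A(z), B(z), C(z), D(z) be entire functions, where C and D are of exponential type and A and C are not identically zero. Suppose ψ is a continuous real-valued function on ℝ such that for all real x one has A(x)ψ(x) = B(x) and C(x)e^{iψ(x)} = D(x). Then ψ is an affine function: ψ(x) = ax + b with a, b ∈ ℝ. -/

import Mathlib

open Complex

/-- An entire function `F` is of exponential type if `|F z| = O(e^{b|z|})` for some `b > 0`. -/
def ExpType (F : ℂ → ℂ) : Prop :=
  ∃ b > (0 : ℝ), ∃ c : ℝ, ∀ z : ℂ, ‖F z‖ ≤ c * Real.exp (b * ‖z‖)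

open Filter Topology ValueDistribution

/-- A solution `q` of `G' = q' G`, with `G` meromorphic and not locally zero, has no pole. -/
lemma meromorphicOrderAt_nonneg_of_deriv_eq_deriv_mul {q G : ℂ → ℂ} {w : ℂ}
    (hG : MeromorphicAt G w) (hG0 : meromorphicOrderAt G w ≠ ⊤)
    (h : deriv G =ᶠ[𝓝[≠] w] deriv q * G) : 0 ≤ meromorphicOrderAt q w := by
  by_contra! hlt
  obtain ⟨k, hk⟩ := WithTop.ne_top_iff_exists.1 hlt.ne_top
  have hk0 : k < 0 := by
    rw [← hk] at hlt
    exact_mod_cast hlt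
  have hq : MeromorphicAt q w := meromorphicAt_of_meromorphicOrderAt_ne_zero hlt.ne
  obtain ⟨n, hn⟩ := WithTop.ne_top_iff_exists.1 hG0
  have hq' : meromorphicOrderAt (deriv q) w = ↑(k - 1) :=
    meromorphicOrderAt_deriv_eq_sub_one (by exact_mod_cast hk0.ne) hk.symm
  have hG' : meromorphicOrderAt (deriv G) w = ↑(k - 1 + n) := by
    rw [meromorphicOrderAt_congr h, meromorphicOrderAt_mul hq.deriv hG, hq', ← hn]
    norm_cast
  rcases eq_or_ne n 0 with rfl | hn0
  · obtain ⟨g, hg, -, hgG⟩ := (meromorphicOrderAt_eq_int_iff hG).1 hn.symm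
    have hgG' : G =ᶠ[𝓝[≠] w] g := by
      filter_upwards [hgG] with z hz
      simpa using hz
    have hnonneg := hg.deriv.meromorphicOrderAt_nonneg
    rw [← meromorphicOrderAt_congr hgG'.nhdsNE_deriv, hG'] at hnonneg
    have : 0 ≤ k - 1 + 0 := by exact_mod_cast hnonneg
    omega
  · rw [meromorphicOrderAt_deriv_eq_sub_one (by exact_mod_cast hn0) hn.symm] at hG'
    have : n - 1 = k - 1 + n := by exact_mod_cast hG'
    omega

lemma Differentiable.eventually_ne_zero_nhdsNE {A : ℂ → ℂ} (hA : Differentiable ℂ A)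
    (hA0 : ∃ z, A z ≠ 0) (w : ℂ) : ∀ᶠ z in 𝓝[≠] w, A z ≠ 0 := by
  by_contra hf
  obtain ⟨z, hz⟩ := hA0
  refine hz (congrFun (AnalyticOnNhd.eq_of_frequently_eq (𝕜 := ℂ) (z₀ := w) (f := A) (g := 0)
    (fun x _ ↦ hA.analyticAt x) (fun x _ ↦ analyticAt_const) ?_) z)
  exact (not_eventually.1 hf).mono fun x hx ↦ not_not.1 hx

lemma Differentiable.meromorphic {A : ℂ → ℂ} (hA : Differentiable ℂ A) : Meromorphic A :=
  fun z ↦ (hA.analyticAt z).meromorphicAt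

/-- A quotient of entire functions without poles is entire. -/
lemma exists_entire_mul_eq {A B : ℂ → ℂ} (hA : Differentiable ℂ A) (hB : Differentiable ℂ B)
    (hA0 : ∃ z, A z ≠ 0) (h : ∀ w, 0 ≤ meromorphicOrderAt (B / A) w) :
    ∃ f : ℂ → ℂ, Differentiable ℂ f ∧ ∀ z, A z * f z = B z := by
  have hm : MeromorphicOn (B / A) Set.univ := fun z _ ↦ (hB.meromorphic z).div (hA.meromorphic z)
  have hf : Differentiable ℂ (toMeromorphicNFOn (B / A) Set.univ) := fun z ↦ by
    refine AnalyticAt.differentiableAt ?_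
    rw [← (meromorphicNFOn_toMeromorphicNFOn (B / A) Set.univ
      (Set.mem_univ z)).meromorphicOrderAt_nonneg_iff_analyticAt,
      meromorphicOrderAt_toMeromorphicNFOn hm (Set.mem_univ z)]
    exact h z
  refine ⟨_, hf, fun z ↦ ?_⟩
  refine congrFun (AnalyticOnNhd.eq_of_frequently_eq (𝕜 := ℂ) (z₀ := z)
    (f := fun z ↦ A z * toMeromorphicNFOn (B / A) Set.univ z) (g := B)
    (fun x _ ↦ (hA.mul hf).analyticAt x) (fun x _ ↦ hB.analyticAt x) ?_) z
  refine Eventually.frequently ?_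
  filter_upwards [hm.toMeromorphicNFOn_eq_self_on_nhdsNE (Set.mem_univ z),
    hA.eventually_ne_zero_nhdsNE hA0 z] with x hx hx0
  rw [hx, Pi.div_apply, mul_div_cancel₀ _ hx0]

/-- An entire function of at most linear growth is affine. -/
lemma exists_affine_of_entire_of_norm_le {f : ℂ → ℂ} (hf : Differentiable ℂ f) {K : ℝ}
    (hK : ∀ z, ‖f z‖ ≤ K * (1 + ‖z‖)) : ∃ a b : ℂ, ∀ z, f z = a * z + b := by
  have hK0 : 0 ≤ K := by simpa using (norm_nonneg _).trans (hK 0)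
  have hd : ∀ z, ‖deriv f z‖ ≤ 2 * K := fun z ↦ by
    have hz : 0 < 1 + ‖z‖ := by positivity
    have := norm_deriv_le_of_forall_mem_sphere_norm_le (c := z) (C := 2 * K * (1 + ‖z‖)) hz
      hf.diffContOnCl (fun w hw ↦ (hK w).trans ?_)
    · rwa [mul_div_cancel_right₀ _ hz.ne'] at this
    · have hw' : ‖w - z‖ = 1 + ‖z‖ := by simpa [dist_eq_norm] using hw
      nlinarith [norm_le_norm_sub_add w z]
  have hd' : Differentiable ℂ (deriv f) := (hf.contDiff (n := 2)).differentiable_deriv_two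
  obtain ⟨a, ha⟩ := hd'.exists_const_forall_eq_of_bounded
    (isBounded_iff_forall_norm_le.2 ⟨2 * K, by rintro _ ⟨z, rfl⟩; exact hd z⟩)
  refine ⟨a, f 0, fun z ↦ ?_⟩
  have hg : Differentiable ℂ fun z ↦ f z - a * z := by fun_prop
  have := is_const_of_deriv_eq_zero hg (fun x ↦ by
    rw [deriv_fun_sub hf.differentiableAt (by fun_prop), ha]
    simp) z 0
  simp only [mul_zero, sub_zero] at this
  rw [← this]
  ring

/-- An entire function whose exponential has proximity function of at most linear growth is
affine. -/
lemma exists_affine_of_proximity_exp_le {f : ℂ → ℂ} (hf : Differentiable ℂ f)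
    {K : ℝ} (hK : ∀ r, 1 ≤ r → proximity (fun z ↦ Complex.exp (f z)) ⊤ r ≤ K * r) :
    ∃ a b : ℂ, ∀ z, f z = a * z + b := by
  have hK0 : 0 ≤ K := by simpa using (proximity_nonneg 1).trans (hK 1 le_rfl)
  have hre : ∀ r : ℝ, 1 ≤ r → ∀ w : ℂ, ‖w‖ < r → (f w).re ≤ 6 * K * r := by
    intro r hr w hw
    have hr0 : 0 < r := by linarith
    have hwb : w ∈ Metric.ball (0 : ℂ) (2 * r) := by
      rw [mem_ball_zero_iff]
      linarith
    have hker : ContinuousOn (Complex.re ∘ herglotzRieszKernel 0 w) (Metric.sphere 0 |2 * r|) :=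
      Complex.continuous_re.comp_continuousOn (continuousOn_herglotzRieszKernel_sphere hwb)
    have hP := (hf.diffContOnCl
      (s := Metric.ball 0 (2 * r))).circleAverage_re_herglotzRieszKernel_smul hwb
    have hint : CircleIntegrable ((Complex.re ∘ herglotzRieszKernel 0 w) • f) 0 (2 * r) :=
      ContinuousOn.circleIntegrable' (hker.smul hf.continuous.continuousOn)
    have hcomm := Complex.reCLM.circleAverage_comp_comm hint
    rw [hP] at hcomm
    have hmono : Real.circleAverage (Complex.reCLM ∘ ((Complex.re ∘ herglotzRieszKernel 0 w) • f))
        0 (2 * r) ≤ Real.circleAverage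
          ((3 : ℝ) • fun z ↦ Real.posLog ‖Complex.exp (f z)‖) 0 (2 * r) := by
      refine Real.circleAverage_mono ?_ ?_ fun z hz ↦ ?_
      · exact ContinuousOn.circleIntegrable'
          (Complex.reCLM.continuous.comp_continuousOn (hker.smul hf.continuous.continuousOn))
      · have : Continuous fun z ↦ Real.posLog ‖Complex.exp (f z)‖ := by
          have := hf.continuous
          simp only [Real.posLog, Complex.norm_exp, Real.log_exp]
          fun_prop
        exact (this.const_smul (3 : ℝ)).continuousOn.circleIntegrable'
      · rw [abs_of_pos (by positivity)] at hz
        have h0 := le_re_herglotzRieszKernel hz hwb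
        have h3 := re_herglotzRieszKernel_le hz hwb
        simp only [sub_zero] at h0 h3
        have h0' : 0 ≤ ((z + w) / (z - w)).re :=
          le_trans (div_nonneg (by linarith) (by positivity)) h0
        have h3' : ((z + w) / (z - w)).re ≤ 3 := by
          refine h3.trans ?_
          rw [div_le_iff₀ (by linarith)]
          linarith
        have hpos : (f z).re ≤ Real.posLog ‖Complex.exp (f z)‖ := by
          simp [Real.posLog, Complex.norm_exp]
        have hpos0 := Real.posLog_nonneg (x := ‖Complex.exp (f z)‖)
        have : (herglotzRieszKernel 0 w z).re * (f z).re ≤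
            3 * Real.posLog ‖Complex.exp (f z)‖ := by
          simp only [herglotzRieszKernel_def, sub_zero]
          nlinarith
        simpa using this
    rw [Real.circleAverage_smul, ← proximity_top] at hmono
    have := hK (2 * r) (by linarith)
    simp only [smul_eq_mul, reCLM_apply] at hmono hcomm
    linarith
  refine exists_affine_of_entire_of_norm_le hf (K := 24 * K + 24 + 3 * ‖f 0‖) fun z ↦ ?_
  have hz : 0 ≤ ‖z‖ := norm_nonneg z
  have hR : 0 < 2 * (1 + ‖z‖) := by positivity
  have hbc := borelCaratheodory (M := 12 * (K + 1) * (1 + ‖z‖)) (R := 2 * (1 + ‖z‖)) (z := z)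
    (by positivity) hf.differentiableOn
    (fun w hw ↦ ?_) hR (by rw [mem_ball_zero_iff]; linarith)
  · refine hbc.trans ?_
    rw [← add_div, div_le_iff₀ (by linarith)]
    nlinarith [norm_nonneg (f 0), mul_nonneg hK0 hz, mul_nonneg (norm_nonneg (f 0)) hz,
      mul_nonneg hz hz, mul_nonneg (mul_nonneg hK0 hz) hz,
      mul_nonneg (mul_nonneg (norm_nonneg (f 0)) hz) hz]
  · have := hre (2 * (1 + ‖z‖)) (by linarith) w (by simpa using hw)
    change (f w).re ≤ _
    nlinarith

lemma ExpType.proximity_le {F : ℂ → ℂ} (hF : Differentiable ℂ F) (ht : ExpType F) :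
    ∃ K, ∀ r, 1 ≤ r → proximity F ⊤ r ≤ K * r := by
  obtain ⟨b, hb, c, hc⟩ := ht
  refine ⟨Real.posLog c + b, fun r hr ↦ ?_⟩
  rw [proximity_top]
  refine (Real.circleAverage_mono_on_of_le_circle (a := Real.posLog c + b * r)
    (MeromorphicOn.circleIntegrable_posLog_norm fun z _ ↦ hF.meromorphic z) fun z hz ↦ ?_).trans ?_
  · have hz' : ‖z‖ = r := by simpa [abs_of_pos (zero_lt_one.trans_le hr)] using hz
    refine (Real.posLog_le_posLog (norm_nonneg _) (hc z)).trans (Real.posLog_mul.trans ?_)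
    have : 0 ≤ b * r := by positivity
    simp [Real.posLog_def, hz', this]
  · nlinarith [Real.posLog_nonneg (x := c)]

lemma Differentiable.logCounting_top {F : ℂ → ℂ} (hF : Differentiable ℂ F) :
    logCounting F ⊤ = 0 := by
  have : (MeromorphicOn.divisor F Set.univ)⁻ = 0 :=
    negPart_eq_zero.2 (MeromorphicOn.AnalyticOnNhd.divisor_nonneg fun z _ ↦ hF.analyticAt z)
  rw [ValueDistribution.logCounting_top, this]
  simp

lemma ExpType.proximity_inv_le {F : ℂ → ℂ} (hF : Differentiable ℂ F) (ht : ExpType F) :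
    ∃ K, ∀ r, 1 ≤ r → proximity F⁻¹ ⊤ r ≤ K * r := by
  obtain ⟨K, hK⟩ := ht.proximity_le hF
  set M := max |Real.log ‖F 0‖| |Real.log ‖meromorphicTrailingCoeffAt F 0‖|
  refine ⟨K + M, fun r hr ↦ ?_⟩
  have h1 := (abs_le.1 (characteristic_sub_characteristic_inv_le hF.meromorphic (R := r))).1
  have h2 : 0 ≤ logCounting F⁻¹ ⊤ r := logCounting_nonneg hr
  have hM : 0 ≤ M := (abs_nonneg _).trans (le_max_left _ _)
  simp only [characteristic, Pi.add_apply, hF.logCounting_top, Pi.zero_apply, add_zero] at h1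
  nlinarith [hK r hr]

/-- If `C e^f = D` with `C`, `D` of exponential type, `C ≠ 0` and `f` entire, then `f` is affine. -/
lemma ExpType.exists_affine_of_mul_exp_eq {C D f : ℂ → ℂ} (hC : Differentiable ℂ C)
    (hD : Differentiable ℂ D) (hf : Differentiable ℂ f) (hCt : ExpType C) (hDt : ExpType D)
    (hC0 : ∃ z, C z ≠ 0) (h : ∀ z, C z * Complex.exp (f z) = D z) :
    ∃ a b : ℂ, ∀ z, f z = a * z + b := by
  obtain ⟨K, hK⟩ := hDt.proximity_le hD
  obtain ⟨L, hL⟩ := hCt.proximity_inv_le hC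
  refine exists_affine_of_proximity_exp_le hf (K := K + L) fun r hr ↦ ?_
  have hcod : (fun z ↦ Complex.exp (f z)) =ᶠ[codiscrete ℂ] D * C⁻¹ := by
    rw [EventuallyEq, Filter.Eventually, mem_codiscrete]
    intro w
    rw [Filter.disjoint_principal_right, compl_compl]
    filter_upwards [hC.eventually_ne_zero_nhdsNE hC0 w] with z hz
    simp only [Pi.mul_apply, Pi.inv_apply, ← h]
    field_simp
  rw [proximity_congr_codiscrete hcod (by positivity)]
  have := proximity_mul_top_le hD.meromorphic hC.meromorphic.inv r
  simp only [Pi.add_apply] at this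
  linarith [hK r hr, hL r hr]

/-- A property holding frequently on the real line near `x` holds frequently near `x` in `ℂ`. -/
lemma frequently_ofReal_nhdsNE {p : ℂ → Prop} {x : ℝ} (h : ∃ᶠ y : ℝ in 𝓝[≠] x, p y) :
    ∃ᶠ z in 𝓝[≠] (x : ℂ), p z := by
  refine Tendsto.frequently (f := ((↑) : ℝ → ℂ)) ?_ h
  exact tendsto_nhdsWithin_of_tendsto_nhds_of_eventually_within _
    (Complex.continuous_ofReal.continuousAt.tendsto.mono_left nhdsWithin_le_nhds)
    (by filter_upwards [self_mem_nhdsWithin] with y hy; simpa using hy)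

/-- Entire functions agreeing on the real line are equal. -/
lemma Differentiable.eq_of_eq_ofReal {F G : ℂ → ℂ} (hF : Differentiable ℂ F)
    (hG : Differentiable ℂ G) (h : ∀ x : ℝ, F x = G x) : F = G :=
  AnalyticOnNhd.eq_of_frequently_eq (𝕜 := ℂ) (z₀ := ((0 : ℝ) : ℂ))
    (fun x _ ↦ hF.analyticAt x) (fun x _ ↦ hG.analyticAt x)
    (frequently_ofReal_nhdsNE (Eventually.of_forall h).frequently)

/-- Differentiating `C e^q = D` for `q = N / A` and clearing denominators. -/
lemma wronskian_relation {A N C D : ℂ → ℂ} (hA : Differentiable ℂ A) (hN : Differentiable ℂ N)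
    (hC : Differentiable ℂ C) (hD : Differentiable ℂ D) {x₀ : ℝ} (hx₀ : A x₀ ≠ 0)
    (h : ∀ x : ℝ, A x ≠ 0 → C x * Complex.exp (N x / A x) = D x) (z : ℂ) :
    A z ^ 2 * (deriv D z * C z - D z * deriv C z) =
      (deriv N z * A z - N z * deriv A z) * (C z * D z) := by
  have hAe : ∀ᶠ z in 𝓝 (x₀ : ℂ), A z ≠ 0 := hA.continuous.continuousAt.eventually_ne hx₀
  have heq : ∀ᶠ z in 𝓝 (x₀ : ℂ), C z * Complex.exp (N z / A z) = D z := by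
    refine (AnalyticAt.frequently_eq_iff_eventually_eq (f := fun z ↦ C z * Complex.exp (N z / A z))
      ((hC.analyticAt _).mul ((hN.analyticAt _).div (hA.analyticAt _) hx₀).cexp)
      (hD.analyticAt _)).1 (frequently_ofReal_nhdsNE (Eventually.frequently ?_))
    have : ∀ᶠ y : ℝ in 𝓝 x₀, A y ≠ 0 := Complex.continuous_ofReal.continuousAt.eventually hAe
    filter_upwards [this.filter_mono nhdsWithin_le_nhds] with y hy using h y hy
  have hdA := (hA.contDiff (n := 2)).differentiable_deriv_two
  have hdN := (hN.contDiff (n := 2)).differentiable_deriv_two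
  have hdC := (hC.contDiff (n := 2)).differentiable_deriv_two
  have hdD := (hD.contDiff (n := 2)).differentiable_deriv_two
  refine congrFun (AnalyticOnNhd.eq_of_eventuallyEq (𝕜 := ℂ) (z₀ := (x₀ : ℂ))
    (f := fun z ↦ A z ^ 2 * (deriv D z * C z - D z * deriv C z))
    (g := fun z ↦ (deriv N z * A z - N z * deriv A z) * (C z * D z))
    (fun x _ ↦ Differentiable.analyticAt (by fun_prop) x)
    (fun x _ ↦ Differentiable.analyticAt (by fun_prop) x) ?_) z
  filter_upwards [heq.eventually_nhds, hAe] with z hz hz0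
  have hd : HasDerivAt (fun z ↦ C z * Complex.exp (N z / A z)) _ z :=
    (hC z).hasDerivAt.mul (((hN z).hasDerivAt.div (hA z).hasDerivAt hz0).cexp)
  have hD' : deriv D z = _ := (EventuallyEq.deriv_eq (f₁ := D) (hz.mono fun _ h ↦ h.symm)).trans
    hd.deriv
  rw [hD', ← hz.self_of_nhds]
  simp only [Pi.div_apply]
  field_simp
  ring

/-- Lemma 1: if `A, B, C, D` are entire, `C, D` of exponential type, `A, C` not identically
zero, and a continuous real function `ψ` satisfies `A(x) ψ(x) = B(x)` and
`C(x) e^{iψ(x)} = D(x)` for all real `x`, then `ψ` is affine. -/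
theorem psi_affine_of_entire_relations
    (A B C D : ℂ → ℂ)
    (hA : Differentiable ℂ A) (hB : Differentiable ℂ B)
    (hC : Differentiable ℂ C) (hD : Differentiable ℂ D)
    (hCt : ExpType C) (hDt : ExpType D)
    (hA0 : ∃ z : ℂ, A z ≠ 0) (hC0 : ∃ z : ℂ, C z ≠ 0)
    (ψ : ℝ → ℝ) (hψ : Continuous ψ)
    (h2 : ∀ x : ℝ, A x * (ψ x : ℂ) = B x)
    (h3 : ∀ x : ℝ, C x * Complex.exp (Complex.I * (ψ x : ℂ)) = D x) :
    ∃ a b : ℝ, ∀ x : ℝ, ψ x = a * x + b := by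
  obtain ⟨x₀, hx₀⟩ : ∃ x : ℝ, A x ≠ 0 := by
    by_contra! hz
    obtain ⟨z, hz0⟩ := hA0
    exact hz0 (congrFun (hA.eq_of_eq_ofReal (differentiable_const 0) hz) z)
  have hD0 : ∃ z, D z ≠ 0 := by
    by_contra! hz
    obtain ⟨z, hz0⟩ := hC0
    refine hz0 (congrFun (hC.eq_of_eq_ofReal (differentiable_const 0) fun x ↦ ?_) z)
    simpa [hz] using h3 x
  have hN : Differentiable ℂ fun z ↦ I * B z := hB.const_mul I
  have hW := wronskian_relation hA hN hC hD hx₀ fun x hx ↦ by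
    rw [← h3 x, ← h2 x]
    congr 2
    field_simp
  obtain ⟨f, hf, hAf⟩ := exists_entire_mul_eq hA hN hA0 fun w ↦ by
    refine meromorphicOrderAt_nonneg_of_deriv_eq_deriv_mul (G := D / C)
      ((hD.meromorphic w).div (hC.meromorphic w)) ?_ ?_
    · rw [meromorphicOrderAt_ne_top_iff_eventually_ne_zero
        ((hD.meromorphic w).div (hC.meromorphic w))]
      filter_upwards [hC.eventually_ne_zero_nhdsNE hC0 w, hD.eventually_ne_zero_nhdsNE hD0 w]
        with z hz hz' using div_ne_zero hz' hz
    · filter_upwards [hC.eventually_ne_zero_nhdsNE hC0 w, hA.eventually_ne_zero_nhdsNE hA0 w]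
        with z hz hz'
      rw [Pi.mul_apply, deriv_div (hD z) (hC z) hz, deriv_div (hN z) (hA z) hz', Pi.div_apply]
      have := hW z
      field_simp
      linear_combination this
  have hfψ : ∀ x : ℝ, f x = I * ψ x := by
    have hcont : Continuous fun x : ℝ ↦ f x := hf.continuous.comp Complex.continuous_ofReal
    have hcont' : Continuous fun x : ℝ ↦ I * (ψ x : ℂ) := by fun_prop
    have hdense : Dense {x : ℝ | A x ≠ 0} := by
      intro x
      rw [mem_closure_iff_frequently]
      by_contra hx
      obtain ⟨z, hz⟩ := hA0
      have hzero : ∀ᶠ y : ℝ in 𝓝[≠] x, A y = 0 := by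
        simpa using (not_frequently.1 hx).filter_mono nhdsWithin_le_nhds
      refine frequently_ofReal_nhdsNE (p := fun z ↦ A z = 0) hzero.frequently ?_
      exact hA.eventually_ne_zero_nhdsNE ⟨z, hz⟩ x
    refine congrFun (hcont.ext_on hdense hcont' fun x hx ↦ mul_left_cancel₀ hx ?_)
    rw [hAf, ← h2 x]
    ring
  have hCD : ∀ z, C z * Complex.exp (f z) = D z := congrFun <|
    Differentiable.eq_of_eq_ofReal (F := fun z ↦ C z * Complex.exp (f z)) (by fun_prop) hD
      fun x ↦ by simp only [hfψ, h3]
  obtain ⟨a, b, hab⟩ := hCt.exists_affine_of_mul_exp_eq hC hD hf hDt hC0 hCD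
  refine ⟨ψ 1 - ψ 0, ψ 0, fun x ↦ ?_⟩
  have e : ∀ x : ℝ, I * (ψ x : ℂ) = a * x + b := fun x ↦ by rw [← hfψ, hab]
  have key : (ψ x : ℂ) = (ψ 1 - ψ 0) * x + ψ 0 := by
    refine mul_left_cancel₀ I_ne_zero ?_
    have e0 := e 0
    have e1 := e 1
    push_cast at e0 e1
    linear_combination e x - x * e1 + (x - 1) * e0
  exact_mod_cast key
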